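/- Let d ≥ 1 and let V : ℤ^d → ℝ be bounded. There is a constant C > 0 depending only on d and ‖V‖_∞ such that for every E ∈ ℝ and every 0 < ε ≤ 1/2, limsup_{L→∞} sup_{x₀∈ℤ^d} (1/|Λ_L(x₀)|) · (number of eigenvalues, counted with multiplicity, of H_{Λ_L(x₀)} lying in [E, E+ε]) ≤ C / log(1/ε). In particular, this limsup tends to 0 as ε → 0, i.e. the density of states outer-measure with Dirichlet boundary condition is continuous. -/

import Mathlib

noncomputable section

/-- The discrete box `Λ_L(x₀) = {y ∈ ℤ^d : ‖y - x₀‖_∞ ≤ L/2}`, as a finite set.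
(For an integer `k` one has `|k| ≤ L/2 ↔ |k| ≤ ⌊L/2⌋`.) -/
def boxZ (d : ℕ) (x₀ : Fin d → ℤ) (L : ℝ) : Finset (Fin d → ℤ) :=
  Fintype.piFinset fun i => Finset.Icc (x₀ i - ⌊L / 2⌋) (x₀ i + ⌊L / 2⌋)

/-- The matrix of the finite-volume discrete Schrödinger operator `H_Λ = -Δ_Λ + V` with
Dirichlet (simple) boundary condition:
`(H_Λ ψ)(x) = -∑_{y ∈ Λ, ‖x-y‖₁ = 1} ψ(y) + V(x) ψ(x)` for `x ∈ Λ`. -/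
def hamMat (d : ℕ) (V : (Fin d → ℤ) → ℝ) (Λ : Finset (Fin d → ℤ)) :
    Matrix ↥Λ ↥Λ ℂ := fun x y =>
  (if (∑ i, |x.1 i - y.1 i|) = 1 then -1 else 0) + (if x = y then (V x.1 : ℂ) else 0)

/-- The finite-volume operator `H_Λ` acting on `ℓ²(Λ)`. -/
def ham (d : ℕ) (V : (Fin d → ℤ) → ℝ) (Λ : Finset (Fin d → ℤ)) :
    (↥Λ → ℂ) →ₗ[ℂ] (↥Λ → ℂ) :=
  Matrix.toLin' (hamMat d V Λ)

/-- The number of eigenvalues of `H_Λ` in `[E, E+ε]`, counted with multiplicity, i.e. the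
dimension of the span of the eigenspaces of `H_Λ` for eigenvalues `μ ∈ [E, E+ε]`. -/
def eigCount (d : ℕ) (V : (Fin d → ℤ) → ℝ) (Λ : Finset (Fin d → ℤ)) (E ε : ℝ) : ℕ :=
  Module.finrank ℂ
    ↥(⨆ μ ∈ Set.Icc E (E + ε), Module.End.eigenspace (ham d V Λ) (μ : ℂ))

end

open Filter ENNReal

/-- A discrete Carleman-type estimate: if `ψ x` is controlled by the values of `φ` and `ψ` at
points of strictly smaller height, then the weighted norm of `ψ` is bounded by that of `φ`. -/
lemma weighted_sum_sq_le {ι : Type*} [Fintype ι] [DecidableEq ι] (a b : ι → ℝ) (p : ι → ℕ)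
    (q : ι → Finset ι) (D M t : ℝ) (hD : 0 < D) (hM : 1 ≤ M) (ht : 0 < t)
    (htD : 4 * D ^ 2 * M ^ 2 * t ≤ 1) (ht1 : t ≤ 1)
    (ha : ∀ x, 0 ≤ a x) (hp : ∀ x, ∀ y ∈ q x, p y < p x)
    (hcard : ∀ x, ((q x).card : ℝ) ≤ D)
    (hcard' : ∀ y, ((Finset.univ.filter fun x => y ∈ q x).card : ℝ) ≤ D)
    (h : ∀ x, a x ≤ ∑ y ∈ q x, (b y + M * a y)) :
    ∑ x, t ^ p x * a x ^ 2 ≤ ∑ x, b x ^ 2 := by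
  have hpt : ∀ x, t ^ p x * a x ^ 2 ≤
      ∑ y ∈ q x, 2 * D * t * (b y ^ 2 + M ^ 2 * (t ^ p y * a y ^ 2)) := by
    intro x
    have h1 : a x ^ 2 ≤ D * ∑ y ∈ q x, (b y + M * a y) ^ 2 :=
      calc a x ^ 2 ≤ (∑ y ∈ q x, (b y + M * a y)) ^ 2 := pow_le_pow_left₀ (ha x) (h x) 2
        _ ≤ (q x).card * ∑ y ∈ q x, (b y + M * a y) ^ 2 := sq_sum_le_card_mul_sum_sq
        _ ≤ _ := by
          gcongr
          exact hcard x
    calc t ^ p x * a x ^ 2 ≤ t ^ p x * (D * ∑ y ∈ q x, (b y + M * a y) ^ 2) := by gcongr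
      _ = ∑ y ∈ q x, D * (t ^ p x * (b y + M * a y) ^ 2) := by
          rw [Finset.mul_sum, Finset.mul_sum]
          exact Finset.sum_congr rfl fun y _ => by ring
      _ ≤ _ := by
          refine Finset.sum_le_sum fun y hy => ?_
          have h2 : t ^ p x ≤ t * t ^ p y := by
            rw [← pow_succ']
            exact pow_le_pow_of_le_one ht.le ht1 (hp x y hy)
          have h3 : t ^ p y ≤ 1 := pow_le_one₀ ht.le ht1
          have h4 : (b y + M * a y) ^ 2 ≤ 2 * (b y ^ 2 + M ^ 2 * a y ^ 2) := by
            nlinarith [sq_nonneg (b y - M * a y)]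
          calc D * (t ^ p x * (b y + M * a y) ^ 2)
              ≤ D * ((t * t ^ p y) * (2 * (b y ^ 2 + M ^ 2 * a y ^ 2))) := by gcongr
            _ = 2 * D * t * (t ^ p y * b y ^ 2 + M ^ 2 * (t ^ p y * a y ^ 2)) := by ring
            _ ≤ _ := by
              have : t ^ p y * b y ^ 2 ≤ b y ^ 2 :=
                mul_le_of_le_one_left (sq_nonneg _) h3
              gcongr
  set N := ∑ x, t ^ p x * a x ^ 2 with hN
  have hN0 : 0 ≤ N := Finset.sum_nonneg fun x _ => by positivity
  set B := ∑ x, b x ^ 2 with hB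
  have hB0 : 0 ≤ B := Finset.sum_nonneg fun x _ => by positivity
  have key : N ≤ 2 * D ^ 2 * t * (B + M ^ 2 * N) := by
    calc N ≤ ∑ x, ∑ y ∈ q x, 2 * D * t * (b y ^ 2 + M ^ 2 * (t ^ p y * a y ^ 2)) :=
          Finset.sum_le_sum fun x _ => hpt x
      _ = ∑ y, ∑ x ∈ Finset.univ.filter (fun x => y ∈ q x),
            2 * D * t * (b y ^ 2 + M ^ 2 * (t ^ p y * a y ^ 2)) :=
          Finset.sum_comm' (by simp)
      _ ≤ ∑ y, D * (2 * D * t * (b y ^ 2 + M ^ 2 * (t ^ p y * a y ^ 2))) := by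
          refine Finset.sum_le_sum fun y _ => ?_
          rw [Finset.sum_const, nsmul_eq_mul]
          gcongr
          exact hcard' y
      _ = _ := by
          rw [hB, hN, Finset.mul_sum Finset.univ _ (M ^ 2), ← Finset.sum_add_distrib,
            Finset.mul_sum]
          exact Finset.sum_congr rfl fun y _ => by ring
  have h5 : 2 * D ^ 2 * t * B ≤ B / 2 := by
    have : 4 * D ^ 2 * t * 1 ≤ 4 * D ^ 2 * t * M ^ 2 := by
      gcongr
      exact one_le_pow₀ hM
    nlinarith
  have h6 : 2 * D ^ 2 * t * (M ^ 2 * N) ≤ N / 2 := by nlinarith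
  linarith [mul_add (2 * D ^ 2 * t) B (M ^ 2 * N)]

/-- On the span of the eigenspaces of a Hermitian matrix `A` for eigenvalues in `[E, E + ε]`,
the operator `A - E` is bounded by `ε` in the Euclidean norm. -/
lemma sum_norm_sq_sub_smul_le {n : Type*} [Fintype n] [DecidableEq n] {A : Matrix n n ℂ}
    (hA : A.IsHermitian) (E ε : ℝ) (ψ : n → ℂ)
    (hψ : ψ ∈ ⨆ μ ∈ Set.Icc E (E + ε),
      Module.End.eigenspace (Matrix.toLin' A) ((μ : ℝ) : ℂ)) :
    ∑ x, ‖(Matrix.toLin' A ψ - (E : ℂ) • ψ) x‖ ^ 2 ≤ ε ^ 2 * ∑ x, ‖ψ x‖ ^ 2 := by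
  rw [iSup_subtype', Submodule.mem_iSup_iff_exists_finsupp] at hψ
  obtain ⟨f, hf, rfl⟩ := hψ
  simp only [Module.End.mem_eigenspace_iff] at hf
  have hT := Matrix.isSymmetric_toEuclideanLin_iff.mpr hA
  let v : ∀ i : Set.Icc E (E + ε),
      Module.End.eigenspace (Matrix.toEuclideanLin A) (((i : ℝ)) : ℂ) := fun i =>
    ⟨WithLp.toLp 2 (f i), by
      rw [Module.End.mem_eigenspace_iff, Matrix.toLpLin_toLp, hf i, WithLp.toLp_smul]⟩
  have horth := (hT.orthogonalFamily_eigenspaces).comp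
    (γ := Set.Icc E (E + ε)) (f := fun i => ((i : ℝ) : ℂ))
    (fun i j hij => Subtype.ext (Complex.ofReal_injective hij))
  have h1 := horth.norm_sum v f.support
  have h2 := horth.norm_sum (fun i => (((i : ℝ) : ℂ) - (E : ℂ)) • v i) f.support
  have e1 : ∑ x, ‖(f.sum fun _ xi => xi) x‖ ^ 2 = ∑ i ∈ f.support, ‖v i‖ ^ 2 := by
    rw [← h1, EuclideanSpace.norm_sq_eq]
    refine Finset.sum_congr rfl fun x _ => ?_
    simp [Finsupp.sum, v]
  have e2 : ∑ x, ‖(Matrix.toLin' A (f.sum fun _ xi => xi) -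
      (E : ℂ) • (f.sum fun _ xi => xi)) x‖ ^ 2 =
      ∑ i ∈ f.support, ‖(((i : ℝ) : ℂ) - (E : ℂ)) • v i‖ ^ 2 := by
    rw [← h2, EuclideanSpace.norm_sq_eq]
    refine Finset.sum_congr rfl fun x _ => ?_
    congr 2
    simp only [Finsupp.sum, map_sum, hf, Finset.smul_sum, ← Finset.sum_sub_distrib, ← sub_smul]
    simp [v]
  rw [e1, e2, Finset.mul_sum]
  refine Finset.sum_le_sum fun i _ => ?_
  rw [norm_smul, mul_pow]
  gcongr
  rw [← Complex.ofReal_sub, Complex.norm_real, Real.norm_eq_abs, abs_le]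
  constructor <;> linarith [i.2.1, i.2.2]

/-- A subspace of functions of dimension larger than `S.card` contains a nonzero function
vanishing on `S`. -/
lemma exists_ne_zero_vanishing_on {n : Type*} [Fintype n] (W : Submodule ℂ (n → ℂ))
    (S : Finset n) (h : S.card < Module.finrank ℂ W) :
    ∃ ψ ∈ W, ψ ≠ 0 ∧ ∀ x ∈ S, ψ x = 0 := by
  let g : W →ₗ[ℂ] (S → ℂ) := (LinearMap.funLeft ℂ ℂ (Subtype.val : S → n)).comp W.subtype
  have hg : LinearMap.ker g ≠ ⊥ := by
    apply LinearMap.ker_ne_bot_of_finrank_lt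
    simpa using h
  obtain ⟨w, hw, hw0⟩ := Submodule.exists_mem_ne_zero_of_ne_bot hg
  refine ⟨w, w.2, by simpa using hw0, fun x hx => ?_⟩
  exact congrFun (LinearMap.mem_ker.mp hw) ⟨x, hx⟩

lemma isHermitian_hamMat (d : ℕ) (V : (Fin d → ℤ) → ℝ) (Λ : Finset (Fin d → ℤ)) :
    (hamMat d V Λ).IsHermitian := by
  ext x y
  simp only [Matrix.conjTranspose_apply, hamMat, abs_sub_comm (y.1 _) (x.1 _)]
  by_cases h : x = y
  · subst h
    simp
  · rw [if_neg h, if_neg (Ne.symm h)]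
    split_ifs <;> simp

lemma norm_hamMat_le (d : ℕ) (V : (Fin d → ℤ) → ℝ) (Λ : Finset (Fin d → ℤ)) (v : ℝ)
    (hV : ∀ x, |V x| ≤ v) (x y : Λ) : ‖hamMat d V Λ x y‖ ≤ 1 + v := by
  have hv : 0 ≤ v := (abs_nonneg _).trans (hV x.1)
  refine (norm_add_le _ _).trans (add_le_add ?_ ?_)
  · split_ifs <;> simp
  · split_ifs
    · simpa using hV x.1
    · simpa using hv

lemma card_l1_ball_le (d : ℕ) (Λ : Finset (Fin d → ℤ)) (x : Λ) (P : Λ → Prop)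
    (hP : ∀ y, P y → ∑ i, |x.1 i - y.1 i| ≤ 2) [DecidablePred P] :
    (Finset.univ.filter P).card ≤ 5 ^ d := by
  have h : (Finset.univ.filter P).card ≤
      (Fintype.piFinset fun i => Finset.Icc (x.1 i - 2) (x.1 i + 2)).card := by
    refine Finset.card_le_card_of_injOn (fun y => y.1) (fun y hy => ?_)
      (fun _ _ _ _ hab => Subtype.ext hab)
    have hy' := hP y (by simpa using hy)
    simp only [Finset.mem_coe, Fintype.mem_piFinset, Finset.mem_Icc]
    intro i
    have h1 : |x.1 i - y.1 i| ≤ 2 :=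
      (Finset.single_le_sum (f := fun i => |x.1 i - y.1 i|) (fun j _ => abs_nonneg _)
        (Finset.mem_univ i)).trans hy'
    rw [abs_le] at h1
    omega
  refine h.trans (le_of_eq ?_)
  rw [Fintype.card_piFinset]
  have : ∀ i, (Finset.Icc (x.1 i - 2) (x.1 i + 2)).card = 5 := fun i => by
    rw [Int.card_Icc]; omega
  simp [this]

/-- Sites of the box lying on the first two layers of a period-`R` slab decomposition in the
direction `i₀` make up a fraction of at most `4 / R` of the box. -/
lemma card_layers_mul_le (d : ℕ) (i₀ : Fin d) (x₀ : Fin d → ℤ) (L : ℝ) (R : ℕ) (hR : 0 < R)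
    (hL : (R : ℝ) ≤ L) :
    ((boxZ d x₀ L).filter fun x => (x i₀ - (x₀ i₀ - ⌊L / 2⌋)) % (R : ℤ) < 2).card * R ≤
      4 * (boxZ d x₀ L).card := by
  set m := ⌊L / 2⌋ with hm
  have hRm : (R : ℤ) ≤ 2 * m + 1 := by
    have h1 : L / 2 < m + 1 := Int.lt_floor_add_one _
    have h2 : (R : ℝ) < ((2 * m + 2 : ℤ) : ℝ) := by push_cast; linarith
    have := Int.cast_lt.mp (show (((R : ℤ) : ℝ)) < ((2 * m + 2 : ℤ) : ℝ) by simpa using h2)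
    omega
  set b := x₀ i₀ - m with hb
  set F : Finset ℤ := (Finset.Icc (x₀ i₀ - m) (x₀ i₀ + m)).filter fun j => (j - b) % (R : ℤ) < 2
    with hF
  have hRpos : (0 : ℤ) < R := by exact_mod_cast hR
  have hFcard : F.card * R ≤ 4 * (2 * m + 1).toNat := by
    have h1 : F.card ≤ ((Finset.Icc (0 : ℤ) (2 * m / R)) ×ˢ (Finset.Icc (0 : ℤ) 1)).card := by
      refine Finset.card_le_card_of_injOn (fun j => ((j - b) / R, (j - b) % R)) ?_ ?_
      · intro j hj
        simp only [hF, Finset.coe_filter, Finset.mem_Icc, Set.mem_ofPred_eq] at hj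
        simp only [Finset.coe_product, Finset.coe_Icc, Set.mem_prod, Set.mem_Icc]
        refine ⟨⟨Int.ediv_nonneg (by omega) hRpos.le, Int.ediv_le_ediv hRpos (by omega)⟩,
          Int.emod_nonneg _ hRpos.ne', by omega⟩
      · intro j _ k _ hjk
        simp only [Prod.mk.injEq] at hjk
        have e1 := Int.mul_ediv_add_emod (j - b) R
        have e2 := Int.mul_ediv_add_emod (k - b) R
        rw [hjk.1, hjk.2] at e1
        omega
    rw [Finset.card_product, Int.card_Icc, Int.card_Icc] at h1
    have h2 : 0 ≤ 2 * m / (R : ℤ) := Int.ediv_nonneg (by omega) hRpos.le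
    have h3 : 2 * m / (R : ℤ) * R ≤ 2 * m := Int.ediv_mul_le _ hRpos.ne'
    have h4 : (F.card : ℤ) ≤ (2 * m / R + 1) * 2 := by
      have : (F.card : ℤ) ≤ (((2 * m / R + 1 - 0).toNat * (1 + 1 - 0 : ℤ).toNat : ℕ) : ℤ) := by
        exact_mod_cast h1
      simpa [Int.toNat_of_nonneg (show (0 : ℤ) ≤ 2 * m / R + 1 by omega)] using this
    have h5 : (F.card : ℤ) * R ≤ 4 * (2 * m + 1) := by nlinarith
    zify
    rw [Int.toNat_of_nonneg (by omega)]
    exact h5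
  have hfilter : (boxZ d x₀ L).filter (fun x => (x i₀ - b) % (R : ℤ) < 2) =
      Fintype.piFinset (Function.update
        (fun i => Finset.Icc (x₀ i - m) (x₀ i + m)) i₀ F) := by
    ext x
    simp only [boxZ, Finset.mem_filter, Fintype.mem_piFinset, ← hm]
    constructor
    · rintro ⟨h1, h2⟩ i
      by_cases hi : i = i₀
      · subst hi
        rw [Function.update_self, hF, Finset.mem_filter]
        exact ⟨h1 i, h2⟩
      · rw [Function.update_of_ne hi]
        exact h1 i
    · intro h
      have h0 := h i₀
      rw [Function.update_self, hF, Finset.mem_filter] at h0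
      refine ⟨fun i => ?_, h0.2⟩
      by_cases hi : i = i₀
      · subst hi
        exact h0.1
      · simpa [Function.update_of_ne hi] using h i
  have hc : ∀ i, (Finset.Icc (x₀ i - m) (x₀ i + m)).card = (2 * m + 1).toNat := fun i => by
    rw [Int.card_Icc]; congr 1; ring
  rw [hfilter, boxZ, Fintype.card_piFinset, Fintype.card_piFinset,
    ← Finset.mul_prod_erase Finset.univ _ (Finset.mem_univ i₀),
    ← Finset.mul_prod_erase Finset.univ _ (Finset.mem_univ i₀), Function.update_self, ← hm, hc]
  have hprod : ∏ i ∈ Finset.univ.erase i₀, (Function.update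
        (fun i => Finset.Icc (x₀ i - m) (x₀ i + m)) i₀ F i).card =
      ∏ i ∈ Finset.univ.erase i₀, (Finset.Icc (x₀ i - m) (x₀ i + m)).card :=
    Finset.prod_congr rfl fun i hi => by rw [Function.update_of_ne (Finset.ne_of_mem_erase hi)]
  rw [hprod]
  calc _ = (F.card * R) * ∏ i ∈ Finset.univ.erase i₀,
        (Finset.Icc (x₀ i - m) (x₀ i + m)).card := by ring
    _ ≤ (4 * (2 * m + 1).toNat) * ∏ i ∈ Finset.univ.erase i₀,
        (Finset.Icc (x₀ i - m) (x₀ i + m)).card := by gcongr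
    _ = _ := by ring

/-- If `‖z - y‖₁ ≤ 1` and `x` is the upper neighbour of `z` in direction `i₀`, then either
`y = x` or `y` lies one or two layers below `x`. -/
lemma layer_lt_of_l1_le_one {d : ℕ} {i₀ : Fin d} {x y z : Fin d → ℤ}
    (hz : z = x - Pi.single i₀ 1) (hzy : ∑ i, |z i - y i| ≤ 1) (hyx : y ≠ x) :
    y i₀ = x i₀ - 1 ∨ y i₀ = x i₀ - 2 := by
  rw [← Finset.add_sum_erase Finset.univ _ (Finset.mem_univ i₀)] at hzy
  have hz0 : z i₀ = x i₀ - 1 := by simp [hz]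
  have hrest : 0 ≤ ∑ i ∈ Finset.univ.erase i₀, |z i - y i| :=
    Finset.sum_nonneg fun _ _ => abs_nonneg _
  have h1 : |z i₀ - y i₀| ≤ 1 := by linarith
  have hne : y i₀ ≠ x i₀ := by
    intro h0
    apply hyx
    have h2 : |z i₀ - y i₀| = 1 := by rw [hz0, h0]; simp
    have h3 : ∑ i ∈ Finset.univ.erase i₀, |z i - y i| = 0 := by linarith
    rw [Finset.sum_eq_zero_iff_of_nonneg fun _ _ => abs_nonneg _] at h3
    ext i
    by_cases hi : i = i₀
    · rw [hi, h0]
    · have h4 := h3 i (by simp [hi])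
      have h5 : z i = x i := by simp [hz, hi]
      rw [abs_eq_zero] at h4
      omega
  rw [abs_le] at h1
  omega

lemma hamMat_eq_zero {d : ℕ} (V : (Fin d → ℤ) → ℝ) {Λ : Finset (Fin d → ℤ)} {x y : Λ}
    (h : 1 < ∑ i, |x.1 i - y.1 i|) : hamMat d V Λ x y = 0 := by
  have hxy : x ≠ y := by
    rintro rfl
    simp at h
  simp [hamMat, h.ne', hxy]

lemma emod_sub_eq {a r k : ℤ} (hk : 0 ≤ k) (hr : 0 < r) (h : k ≤ a % r) :
    (a - k) % r = a % r - k := by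
  have h1 : a - k = (a % r - k) + r * (a / r) := by
    have := Int.mul_ediv_add_emod a r
    omega
  rw [h1, Int.add_mul_emod_self_left,
    Int.emod_eq_of_lt (by omega) (by have := Int.emod_lt_of_pos a hr; omega)]

/-- The number of eigenvalues in a short interval is at most the number of sites on the first
two layers of a slab decomposition: an approximate solution vanishing there is too small. -/
lemma eigCount_le_card_layers {d : ℕ} (i₀ : Fin d) {V : (Fin d → ℤ) → ℝ} {v : ℝ}
    (hV : ∀ x, |V x| ≤ v) (x₀ : Fin d → ℤ) (L : ℝ) {R : ℕ} (hR : 0 < R) {E ε t M : ℝ}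
    (hM : 1 + v + |E| ≤ M) (ht : 0 < t) (htM : 4 * (5 ^ d) ^ 2 * M ^ 2 * t ≤ 1)
    (hεt : ε ^ 2 < t ^ (R - 1)) :
    eigCount d V (boxZ d x₀ L) E ε ≤
      ((boxZ d x₀ L).filter fun x => (x i₀ - (x₀ i₀ - ⌊L / 2⌋)) % (R : ℤ) < 2).card := by
  classical
  by_contra! hlt
  set Λ := boxZ d x₀ L with hΛ
  set b := x₀ i₀ - ⌊L / 2⌋ with hb
  have hRpos : (0 : ℤ) < R := by exact_mod_cast hR
  have hv : 0 ≤ v := (abs_nonneg _).trans (hV 0)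
  have hM1 : 1 ≤ M := by linarith [abs_nonneg E]
  have hD1 : (1 : ℝ) ≤ 5 ^ d := one_le_pow₀ (by norm_num)
  have ht1 : t ≤ 1 := by
    have : (1 : ℝ) * 1 ≤ (4 * (5 ^ d) ^ 2) * M ^ 2 := by
      gcongr
      · linarith [one_le_pow₀ hD1 (n := 2)]
      · exact one_le_pow₀ hM1
    nlinarith
  let S : Finset Λ := Finset.univ.filter fun x => (x.1 i₀ - b) % (R : ℤ) < 2
  have hS : S.card ≤ (Λ.filter fun x => (x i₀ - b) % (R : ℤ) < 2).card :=
    Finset.card_le_card_of_injOn (fun x => x.1)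
      (fun x hx => by simpa [S] using hx) (fun _ _ _ _ h => Subtype.ext h)
  obtain ⟨ψ, hψW, hψ0, hψS⟩ := exists_ne_zero_vanishing_on _ S (hS.trans_lt hlt)
  have hψε := sum_norm_sq_sub_smul_le (isHermitian_hamMat d V Λ) E ε ψ hψW
  set φ : Λ → ℂ := Matrix.toLin' (hamMat d V Λ) ψ - (E : ℂ) • ψ with hφ
  let p : Λ → ℕ := fun x => ((x.1 i₀ - b) % (R : ℤ)).toNat
  have hp : ∀ x, (p x : ℤ) = (x.1 i₀ - b) % (R : ℤ) := fun x =>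
    Int.toNat_of_nonneg (Int.emod_nonneg _ hRpos.ne')
  let q : Λ → Finset Λ := fun x =>
    Finset.univ.filter fun y => ∑ i, |x.1 i - y.1 i| ≤ 2 ∧ p y < p x
  have hmain : ∀ x, ‖ψ x‖ ≤ ∑ y ∈ q x, (‖φ y‖ + M * ‖ψ y‖) := by
    intro x
    by_cases hx0 : ψ x = 0
    · rw [hx0, norm_zero]
      exact Finset.sum_nonneg fun y _ => by positivity
    have hx2 : 2 ≤ (x.1 i₀ - b) % (R : ℤ) := by
      by_contra! h
      exact hx0 (hψS x (Finset.mem_filter.mpr ⟨Finset.mem_univ x, h⟩))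
    have hxΛ := x.2
    simp only [hΛ, boxZ, Fintype.mem_piFinset, Finset.mem_Icc] at hxΛ
    have hzΛ : x.1 - Pi.single i₀ 1 ∈ Λ := by
      simp only [hΛ, boxZ, Fintype.mem_piFinset, Finset.mem_Icc]
      intro i
      have h1 := hxΛ i
      by_cases hi : i = i₀
      · subst hi
        have : x.1 i ≠ b := by
          intro h
          simp [h] at hx2
        simp only [Pi.sub_apply, Pi.single_eq_same]
        omega
      · simpa [hi] using h1
    let z : Λ := ⟨x.1 - Pi.single i₀ 1, hzΛ⟩
    have hxz : ∀ i, |x.1 i - z.1 i| = if i = i₀ then 1 else 0 := by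
      intro i
      by_cases hi : i = i₀
      · subst hi; simp [z]
      · simp [z, hi]
    have hxz1 : ∑ i, |x.1 i - z.1 i| = 1 := by simp [hxz]
    have hzx : z ≠ x := by
      intro h
      rw [h] at hxz1
      simp at hxz1
    have hq : ∀ y : Λ, y ≠ x → ∑ i, |z.1 i - y.1 i| ≤ 1 → y ∈ q x := by
      intro y hyx hy
      simp only [q, Finset.mem_filter, Finset.mem_univ, true_and]
      constructor
      · calc ∑ i, |x.1 i - y.1 i| ≤ ∑ i, (|x.1 i - z.1 i| + |z.1 i - y.1 i|) :=
              Finset.sum_le_sum fun i _ => abs_sub_le _ _ _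
          _ ≤ 2 := by rw [Finset.sum_add_distrib]; omega
      · zify
        rw [hp, hp]
        rcases layer_lt_of_l1_le_one (i₀ := i₀) (x := x.1) (z := z.1) rfl hy
          (fun h => hyx (Subtype.ext h)) with h | h
        · rw [h, sub_right_comm, emod_sub_eq (by norm_num) hRpos (by omega)]
          omega
        · rw [h, sub_right_comm, emod_sub_eq (by norm_num) hRpos (by omega)]
          omega
    have hzq : z ∈ q x := hq z hzx (by simp)
    have hxq : x ∉ q x := by simp [q]
    let g : Λ → ℂ := fun y => hamMat d V Λ z y - if z = y then (E : ℂ) else 0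
    have hgx : g x = -1 := by
      simp only [abs_sub_comm (x.1 _)] at hxz1
      simp [g, hamMat, hzx, hxz1]
    have hg0 : ∀ y, y ∉ insert x (q x) → g y = 0 := by
      intro y hy
      simp only [Finset.mem_insert, not_or] at hy
      have h1 : 1 < ∑ i, |z.1 i - y.1 i| := by
        by_contra! h
        exact hy.2 (hq y hy.1 h)
      have h2 : z ≠ y := fun h => hy.2 (h ▸ hzq)
      simp [g, hamMat_eq_zero V h1, h2]
    have hgM : ∀ y, ‖g y‖ ≤ M := by
      intro y
      refine (norm_sub_le _ _).trans (le_trans (add_le_add (norm_hamMat_le d V Λ v hV z y) ?_) hM)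
      split_ifs
      · simp
      · simp
    have hφz : φ z = -ψ x + ∑ y ∈ q x, g y * ψ y := by
      have h1 : φ z = ∑ y, g y * ψ y := by
        simp [hφ, g, Matrix.mulVec, dotProduct, sub_mul, Finset.sum_sub_distrib]
      rw [h1, ← Finset.sum_subset (Finset.subset_univ (insert x (q x)))
        (fun y _ hy => by rw [hg0 y hy, zero_mul]), Finset.sum_insert hxq, hgx, neg_one_mul]
    have hψx : ψ x = -φ z + ∑ y ∈ q x, g y * ψ y := by rw [hφz]; ring
    calc ‖ψ x‖ ≤ ‖φ z‖ + ∑ y ∈ q x, ‖g y * ψ y‖ := by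
          rw [hψx]
          refine (norm_add_le _ _).trans ?_
          rw [norm_neg]
          gcongr
          exact norm_sum_le _ _
      _ ≤ ∑ y ∈ q x, ‖φ y‖ + ∑ y ∈ q x, M * ‖ψ y‖ := by
          refine add_le_add (Finset.single_le_sum (f := fun y => ‖φ y‖)
            (fun y _ => norm_nonneg _) hzq) (Finset.sum_le_sum fun y _ => ?_)
          rw [norm_mul]
          gcongr
          exact hgM y
      _ = _ := by rw [Finset.sum_add_distrib]
  have hcarl := weighted_sum_sq_le (fun x => ‖ψ x‖) (fun x => ‖φ x‖) p q (5 ^ d) M t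
    (by positivity) hM1 ht htM ht1 (fun x => norm_nonneg _)
    (fun x y hy => by
      simp only [q, Finset.mem_filter] at hy
      exact hy.2.2)
    (fun x => by
      exact_mod_cast card_l1_ball_le d Λ x
        (fun y => ∑ i, |x.1 i - y.1 i| ≤ 2 ∧ p y < p x) (fun y hy => hy.1))
    (fun y => by
      exact_mod_cast card_l1_ball_le d Λ y _ (fun x hx => by
        simp only [q, Finset.mem_filter] at hx
        simpa only [abs_sub_comm (y.1 _)] using hx.2.1))
    hmain
  have hpos : 0 < ∑ x, ‖ψ x‖ ^ 2 := by
    obtain ⟨x, hx⟩ := Function.ne_iff.mp hψ0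
    exact Finset.sum_pos' (fun _ _ => by positivity)
      ⟨x, Finset.mem_univ x, by have : 0 < ‖ψ x‖ := norm_pos_iff.mpr hx
                                positivity⟩
  have hlow : t ^ (R - 1) * ∑ x, ‖ψ x‖ ^ 2 ≤ ∑ x, t ^ p x * ‖ψ x‖ ^ 2 := by
    rw [Finset.mul_sum]
    refine Finset.sum_le_sum fun x _ => ?_
    have h1 : p x ≤ R - 1 := by
      have h2 := hp x
      have h3 := Int.emod_lt_of_pos (x.1 i₀ - b) hRpos
      omega
    gcongr ?_ * _
    exact pow_le_pow_of_le_one ht.le ht1 h1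
  have := mul_lt_mul_of_pos_right hεt hpos
  linarith

/-- If `H_Λ` has an eigenvalue in `[E, E + ε]` with `ε ≤ 1`, then `E` is bounded in terms of the
dimension and the potential, by Gershgorin's theorem. -/
lemma abs_le_of_eigCount_ne_zero {d : ℕ} {V : (Fin d → ℤ) → ℝ} {v : ℝ}
    (hV : ∀ x, |V x| ≤ v) (Λ : Finset (Fin d → ℤ)) {E ε : ℝ} (hε : ε ≤ 1)
    (h : eigCount d V Λ E ε ≠ 0) : |E| ≤ (5 ^ d + 1) * (1 + v) + 1 := by
  classical
  obtain ⟨μ, hμ, hne⟩ : ∃ μ ∈ Set.Icc E (E + ε),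
      Module.End.eigenspace (ham d V Λ) ((μ : ℝ) : ℂ) ≠ ⊥ := by
    by_contra! h0
    apply h
    have : (⨆ μ ∈ Set.Icc E (E + ε), Module.End.eigenspace (ham d V Λ) ((μ : ℝ) : ℂ)) = ⊥ := by
      simpa only [iSup_eq_bot] using h0
    rw [eigCount, this, finrank_bot]
  obtain ⟨k, hk⟩ := eigenvalue_mem_ball (A := hamMat d V Λ) (μ := (μ : ℂ))
    (Module.End.hasEigenvalue_iff.mpr hne)
  have hv : 0 ≤ v := (abs_nonneg _).trans (hV 0)
  have hsum : ∑ j ∈ Finset.univ.erase k, ‖hamMat d V Λ k j‖ ≤ 5 ^ d * (1 + v) := by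
    calc ∑ j ∈ Finset.univ.erase k, ‖hamMat d V Λ k j‖
        ≤ ∑ j, ‖hamMat d V Λ k j‖ :=
          Finset.sum_le_univ_sum_of_nonneg fun _ => norm_nonneg _
      _ = ∑ j ∈ Finset.univ.filter (fun j : Λ => ∑ i, |k.1 i - j.1 i| ≤ 2),
            ‖hamMat d V Λ k j‖ := by
          refine (Finset.sum_subset (Finset.filter_subset _ _) fun j _ hj => ?_).symm
          simp only [Finset.mem_filter, Finset.mem_univ, true_and, not_le] at hj
          rw [hamMat_eq_zero V (by omega), norm_zero]
      _ ≤ (Finset.univ.filter (fun j : Λ => ∑ i, |k.1 i - j.1 i| ≤ 2)).card • (1 + v) :=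
          Finset.sum_le_card_nsmul _ _ _ fun j _ => norm_hamMat_le d V Λ v hV k j
      _ ≤ 5 ^ d * (1 + v) := by
          rw [nsmul_eq_mul]
          gcongr
          exact_mod_cast card_l1_ball_le d Λ k _ fun _ hy => hy
  rw [Metric.mem_closedBall, dist_eq_norm] at hk
  have h1 : |μ| ≤ (5 ^ d + 1) * (1 + v) := by
    have h2 : ‖(μ : ℂ)‖ ≤ ‖(μ : ℂ) - hamMat d V Λ k k‖ + ‖hamMat d V Λ k k‖ := by
      simpa using norm_add_le ((μ : ℂ) - hamMat d V Λ k k) (hamMat d V Λ k k)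
    rw [Complex.norm_real, Real.norm_eq_abs] at h2
    linarith [norm_hamMat_le d V Λ v hV k k]
  rw [abs_le] at h1 ⊢
  constructor <;> linarith [hμ.1, hμ.2]

/-- Uniform bound, for all large boxes, on the fraction of eigenvalues in `[E, E + ε]`. -/
lemma exists_eigCount_div_card_le (d : ℕ) (hd : 1 ≤ d) (v : ℝ) (hv : 0 ≤ v) :
    ∃ C > (0 : ℝ), ∀ V : (Fin d → ℤ) → ℝ, (∀ x, |V x| ≤ v) → ∀ E ε : ℝ, 0 < ε → ε ≤ 1 / 2 →
      ∀ᶠ L : ℝ in atTop, ∀ x₀ : Fin d → ℤ,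
        (eigCount d V (boxZ d x₀ L) E ε : ℝ) ≤
          C / Real.log (1 / ε) * (boxZ d x₀ L).card := by
  set M : ℝ := 1 + v + ((5 ^ d + 1) * (1 + v) + 1) with hM
  have hD1 : (1 : ℝ) ≤ 5 ^ d := one_le_pow₀ (by norm_num)
  have hM1 : 1 ≤ M := by
    have : (0 : ℝ) ≤ (5 ^ d + 1) * (1 + v) := by positivity
    linarith
  set K : ℝ := 4 * (5 ^ d) ^ 2 * M ^ 2 with hK
  have hK1 : 1 < K := by
    have h1 : (1 : ℝ) ≤ (5 ^ d) ^ 2 := one_le_pow₀ hD1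
    have h2 : (1 : ℝ) ≤ M ^ 2 := one_le_pow₀ hM1
    nlinarith
  have hK0 : 0 < K := by linarith
  have hτ : 0 < Real.log K := Real.log_pos hK1
  refine ⟨4 * Real.log K, by positivity, fun V hV E ε hε hε2 => ?_⟩
  have hl : 0 < Real.log (1 / ε) := Real.log_pos (by rw [lt_div_iff₀ hε]; linarith)
  set l := Real.log (1 / ε) with hl_def
  set R : ℕ := ⌊l / Real.log K⌋₊ + 1 with hR
  have hRl : l / Real.log K ≤ R := by
    rw [hR]
    push_cast
    exact (Nat.lt_floor_add_one _).le
  have hR0 : (0 : ℝ) < R := by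
    rw [hR]
    positivity
  have hεt : ε ^ 2 < K⁻¹ ^ (R - 1) := by
    have h1 : ε ≤ K⁻¹ ^ (R - 1) := by
      rw [← Real.log_le_log_iff hε (by positivity), Real.log_pow, Real.log_inv]
      have h2 : ((R - 1 : ℕ) : ℝ) ≤ l / Real.log K := by
        rw [hR, Nat.add_sub_cancel]
        exact Nat.floor_le (by positivity)
      rw [le_div_iff₀ hτ, hl_def, one_div, Real.log_inv] at h2
      linarith
    nlinarith
  filter_upwards [eventually_ge_atTop (R : ℝ)] with L hL x₀
  by_cases h0 : eigCount d V (boxZ d x₀ L) E ε = 0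
  · rw [h0, Nat.cast_zero]
    positivity
  have hE := abs_le_of_eigCount_ne_zero hV _ (by linarith) h0
  have h1 := eigCount_le_card_layers ⟨0, hd⟩ hV x₀ L (Nat.succ_pos _ : 0 < R)
    (M := M) (E := E) (by linarith) (inv_pos.mpr hK0) (mul_inv_cancel₀ hK0.ne').le hεt
  have h2 := card_layers_mul_le d ⟨0, hd⟩ x₀ L R (Nat.succ_pos _) hL
  have h3 : (eigCount d V (boxZ d x₀ L) E ε : ℝ) * R ≤ 4 * (boxZ d x₀ L).card := by
    exact_mod_cast (Nat.mul_le_mul_right R h1).trans h2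
  calc (eigCount d V (boxZ d x₀ L) E ε : ℝ)
      ≤ 4 * (boxZ d x₀ L).card / R := by rwa [le_div_iff₀ hR0]
    _ ≤ 4 * (boxZ d x₀ L).card / (l / Real.log K) := by gcongr
    _ = _ := by
      field_simp

/-- For `d ≥ 1` and bounded `V` there is `C > 0`, depending only on `d`
and `‖V‖_∞`, such that for every `E` and `0 < ε ≤ 1/2`,
`limsup_{L→∞} sup_{x₀} |Λ_L(x₀)|⁻¹ · #{eigenvalues of H_{Λ_L(x₀)} in [E, E+ε]} ≤ C / log(1/ε)`;
in particular this `limsup` tends to `0` as `ε → 0⁺`. -/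
theorem discrete_dos_outer_measure_bound (d : ℕ) (hd : 1 ≤ d) (Vinf : ℝ) :
    ∃ C > (0 : ℝ), ∀ V : (Fin d → ℤ) → ℝ, (∀ x, |V x| ≤ Vinf) →
      (∀ E ε : ℝ, 0 < ε → ε ≤ 1 / 2 →
        Filter.limsup
            (fun L : ℝ => ⨆ x₀ : Fin d → ℤ,
              (eigCount d V (boxZ d x₀ L) E ε : ℝ≥0∞) / ((boxZ d x₀ L).card : ℝ≥0∞))
            Filter.atTop ≤
          ENNReal.ofReal (C / Real.log (1 / ε))) ∧
      (∀ E : ℝ,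
        Filter.Tendsto
          (fun ε : ℝ =>
            Filter.limsup
              (fun L : ℝ => ⨆ x₀ : Fin d → ℤ,
                (eigCount d V (boxZ d x₀ L) E ε : ℝ≥0∞) / ((boxZ d x₀ L).card : ℝ≥0∞))
              Filter.atTop)
          (nhdsWithin 0 (Set.Ioi 0)) (nhds 0)) := by
  obtain ⟨C, hC, hmain⟩ := exists_eigCount_div_card_le d hd |Vinf| (abs_nonneg _)
  refine ⟨C, hC, fun V hV => ?_⟩
  have hbound : ∀ E ε : ℝ, 0 < ε → ε ≤ 1 / 2 →
      Filter.limsup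
          (fun L : ℝ => ⨆ x₀ : Fin d → ℤ,
            (eigCount d V (boxZ d x₀ L) E ε : ℝ≥0∞) / ((boxZ d x₀ L).card : ℝ≥0∞))
          Filter.atTop ≤
        ENNReal.ofReal (C / Real.log (1 / ε)) := by
    intro E ε hε hε2
    have hl : 0 < Real.log (1 / ε) := Real.log_pos (by rw [lt_div_iff₀ hε]; linarith)
    refine Filter.limsup_le_of_le (h := ?_)
    filter_upwards [hmain V (fun x => (hV x).trans (le_abs_self _)) E ε hε hε2] with L hL
    refine iSup_le fun x₀ => ENNReal.div_le_of_le_mul ?_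
    rw [← ENNReal.ofReal_natCast, ← ENNReal.ofReal_natCast,
      ← ENNReal.ofReal_mul (by positivity)]
    exact ENNReal.ofReal_le_ofReal (hL x₀)
  refine ⟨hbound, fun E => ?_⟩
  have hlim : Tendsto (fun ε : ℝ => ENNReal.ofReal (C / Real.log (1 / ε)))
      (nhdsWithin 0 (Set.Ioi 0)) (nhds 0) := by
    rw [← ENNReal.ofReal_zero]
    refine ENNReal.tendsto_ofReal (Tendsto.div_atTop tendsto_const_nhds ?_)
    simp only [one_div]
    exact Real.tendsto_log_atTop.comp tendsto_inv_nhdsGT_zero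
  refine tendsto_of_tendsto_of_tendsto_of_le_of_le' tendsto_const_nhds hlim
    (Filter.Eventually.of_forall fun _ => zero_le) ?_
  filter_upwards [Ioo_mem_nhdsGT (show (0 : ℝ) < 1 / 2 by norm_num)] with ε hε
  exact hbound E ε hε.1 hε.2.le
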